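/- Let μ and ν be Borel probability measures on ℝ supported on [0,∞), and let W_μ(z) = ∫ √x/(z−x) dμ(x). Then for every z ∈ ℂ⁺ the quantity z·G_μ(z)·G_ν(z) − (z·G_μ(z)−1)·(z·G_ν(z)−1) is nonzero, and there exists a unique Borel probability measure λ on ℝ, supported on [0,∞), such that for all z ∈ ℂ⁺: G_λ(z) = G_μ(z) + W_μ(z)²·((z−1)·G_ν(z)−1) / (z·G_μ(z)·G_ν(z) − (z·G_μ(z)−1)·(z·G_ν(z)−1)). (λ is the probabilistically defined multiplicative boolean convolution μ ⊎̃ ν, the distribution of √X Y √X for X−1, Y−1 boolean independent with distributions μ, ν; unlike Bercovici's multiplicative boolean convolution it is always defined.) -/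

import Mathlib

open MeasureTheory

/-- The Cauchy transform `G_ρ(z) = ∫ 1/(z−t) dρ(t)` of a measure on `ℝ`. -/
noncomputable def cauchyTransform (ρ : Measure ℝ) (z : ℂ) : ℂ := ∫ t, (z - (t : ℂ))⁻¹ ∂ρ

/-- The transform `W_ρ(z) = ∫ √t/(z−t) dρ(t)` of a measure on `ℝ`. -/
noncomputable def sqrtCauchyTransform (ρ : Measure ℝ) (z : ℂ) : ℂ :=
  ∫ t, (Real.sqrt t : ℂ) / (z - (t : ℂ)) ∂ρ

section Resolvent

lemma sub_ofReal_ne_zero {z : ℂ} (hz : 0 < z.im) (t : ℝ) : z - (t : ℂ) ≠ 0 := by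
  intro h
  have := congrArg Complex.im h
  simp at this
  exact hz.ne' this

lemma continuous_inv_sub_ofReal {z : ℂ} (hz : 0 < z.im) :
    Continuous fun t : ℝ => (z - (t : ℂ))⁻¹ :=
  (by fun_prop : Continuous fun t : ℝ => z - (t : ℂ)).inv₀ (sub_ofReal_ne_zero hz)

lemma norm_inv_sub_ofReal_le {z : ℂ} (hz : 0 < z.im) (t : ℝ) :
    ‖(z - (t : ℂ))⁻¹‖ ≤ z.im⁻¹ := by
  rw [norm_inv]
  apply inv_anti₀ hz
  have := Complex.abs_im_le_norm (z - (t : ℂ))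
  simp only [Complex.sub_im, Complex.ofReal_im, sub_zero] at this
  exact (le_abs_self _).trans this

lemma ofReal_mul_inv_sub_ofReal {z : ℂ} (hz : 0 < z.im) (t : ℝ) :
    (t : ℂ) * (z - (t : ℂ))⁻¹ = z * (z - (t : ℂ))⁻¹ - 1 := by
  have := sub_ofReal_ne_zero hz t
  field_simp
  ring

lemma norm_ofReal_mul_inv_sub_ofReal_le {z : ℂ} (hz : 0 < z.im) (t : ℝ) :
    ‖(t : ℂ) * (z - (t : ℂ))⁻¹‖ ≤ ‖z‖ * z.im⁻¹ + 1 := by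
  rw [ofReal_mul_inv_sub_ofReal hz]
  refine (norm_sub_le _ _).trans ?_
  rw [norm_mul, norm_one]
  gcongr
  exact norm_inv_sub_ofReal_le hz t

lemma norm_sqrt_div_sub_ofReal_le {z : ℂ} (hz : 0 < z.im) (t : ℝ) :
    ‖(Real.sqrt t : ℂ) / (z - (t : ℂ))‖ ≤ z.im⁻¹ + (‖z‖ * z.im⁻¹ + 1) := by
  have h1 := norm_inv_sub_ofReal_le hz t
  have h2 := norm_ofReal_mul_inv_sub_ofReal_le hz t
  have h3 : Real.sqrt t ≤ 1 + |t| := by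
    rw [Real.sqrt_le_left (by positivity)]
    nlinarith [le_abs_self t, abs_nonneg t]
  rw [norm_mul, Complex.norm_real, Real.norm_eq_abs] at h2
  rw [div_eq_mul_inv, norm_mul, Complex.norm_real, Real.norm_eq_abs,
    abs_of_nonneg (Real.sqrt_nonneg t)]
  nlinarith [norm_nonneg (z - (t : ℂ))⁻¹, mul_le_mul_of_nonneg_right h3
    (norm_nonneg (z - (t : ℂ))⁻¹)]

lemma continuous_sqrt_div_sub_ofReal {z : ℂ} (hz : 0 < z.im) :
    Continuous fun t : ℝ => (Real.sqrt t : ℂ) / (z - (t : ℂ)) := by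
  simp only [div_eq_mul_inv]
  exact (Complex.continuous_ofReal.comp Real.continuous_sqrt).mul (continuous_inv_sub_ofReal hz)

lemma inv_sub_ofReal_im {z : ℂ} (t : ℝ) :
    ((z - (t : ℂ))⁻¹).im = -(z.im * ‖(z - (t : ℂ))⁻¹‖ ^ 2) := by
  rw [Complex.inv_im, norm_inv, inv_pow, ← Complex.normSq_eq_norm_sq]
  simp [div_eq_mul_inv]

variable {ρ : Measure ℝ}

lemma integrable_inv_sub_ofReal [IsFiniteMeasure ρ] {z : ℂ} (hz : 0 < z.im) :
    Integrable (fun t : ℝ => (z - (t : ℂ))⁻¹) ρ :=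
  .of_bound (continuous_inv_sub_ofReal hz).aestronglyMeasurable z.im⁻¹
    (.of_forall (norm_inv_sub_ofReal_le hz))

lemma integrable_ofReal_mul_inv_sub_ofReal [IsFiniteMeasure ρ] {z : ℂ} (hz : 0 < z.im) :
    Integrable (fun t : ℝ => (t : ℂ) * (z - (t : ℂ))⁻¹) ρ :=
  .of_bound (Complex.continuous_ofReal.mul (continuous_inv_sub_ofReal hz)).aestronglyMeasurable _
    (.of_forall (norm_ofReal_mul_inv_sub_ofReal_le hz))

lemma integrable_sqrt_div_sub_ofReal [IsFiniteMeasure ρ] {z : ℂ} (hz : 0 < z.im) :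
    Integrable (fun t : ℝ => (Real.sqrt t : ℂ) / (z - (t : ℂ))) ρ :=
  .of_bound (continuous_sqrt_div_sub_ofReal hz).aestronglyMeasurable _
    (.of_forall (norm_sqrt_div_sub_ofReal_le hz))

lemma integrable_norm_inv_sub_ofReal_sq [IsFiniteMeasure ρ] {z : ℂ} (hz : 0 < z.im) :
    Integrable (fun t : ℝ => ‖(z - (t : ℂ))⁻¹‖ ^ 2) ρ := by
  refine .of_bound ((continuous_inv_sub_ofReal hz).norm.pow 2).aestronglyMeasurable
    (z.im⁻¹ ^ 2) (.of_forall fun t => ?_)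
  rw [norm_pow, norm_norm]
  gcongr
  exact norm_inv_sub_ofReal_le hz t

lemma integral_ofReal_mul_inv_sub_ofReal [IsProbabilityMeasure ρ] {z : ℂ} (hz : 0 < z.im) :
    ∫ t : ℝ, (t : ℂ) * (z - (t : ℂ))⁻¹ ∂ρ = z * cauchyTransform ρ z - 1 := by
  simp_rw [ofReal_mul_inv_sub_ofReal hz]
  rw [integral_sub ((integrable_inv_sub_ofReal hz).const_mul z) (integrable_const _),
    integral_const_mul, cauchyTransform]
  simp

lemma ae_nonneg_of_measure_Iio (h : ρ (Set.Iio 0) = 0) : ∀ᵐ t ∂ρ, 0 ≤ t := by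
  rw [ae_iff]
  simpa [Set.Iio] using h

lemma cauchyTransform_im [IsFiniteMeasure ρ] {z : ℂ} (hz : 0 < z.im) :
    (cauchyTransform ρ z).im = -(z.im * ∫ t : ℝ, ‖(z - (t : ℂ))⁻¹‖ ^ 2 ∂ρ) := by
  rw [cauchyTransform, ← integral_const_mul, ← integral_neg]
  simp_rw [← inv_sub_ofReal_im]
  exact (integral_im (integrable_inv_sub_ofReal hz)).symm

lemma cauchyTransform_im_neg [IsProbabilityMeasure ρ] {z : ℂ} (hz : 0 < z.im) :
    (cauchyTransform ρ z).im < 0 := by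
  rw [cauchyTransform_im hz, neg_lt_zero]
  refine mul_pos hz ?_
  rw [integral_pos_iff_support_of_nonneg (fun t => by positivity)
    (integrable_norm_inv_sub_ofReal_sq hz)]
  have : Function.support (fun t : ℝ => ‖(z - (t : ℂ))⁻¹‖ ^ 2) = Set.univ := by
    ext t
    simp [sub_ofReal_ne_zero hz t]
  rw [this]
  simp

lemma norm_cauchyTransform_sq_le [IsProbabilityMeasure ρ] {z : ℂ} (hz : 0 < z.im) :
    ‖cauchyTransform ρ z‖ ^ 2 ≤ ∫ t : ℝ, ‖(z - (t : ℂ))⁻¹‖ ^ 2 ∂ρ := by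
  set c := ∫ t : ℝ, ‖(z - (t : ℂ))⁻¹‖ ∂ρ with hc
  have h1 : ‖cauchyTransform ρ z‖ ≤ c := norm_integral_le_integral_norm _
  have h2 : 0 ≤ ∫ t : ℝ, (‖(z - (t : ℂ))⁻¹‖ ^ 2 - 2 * c * ‖(z - (t : ℂ))⁻¹‖ + c ^ 2) ∂ρ :=
    integral_nonneg fun t => by
      have := sq_nonneg (‖(z - (t : ℂ))⁻¹‖ - c)
      simp only [Pi.zero_apply]
      linarith
  have h3 := integrable_norm_inv_sub_ofReal_sq (ρ := ρ) hz
  have h4 := (integrable_inv_sub_ofReal (ρ := ρ) hz).norm.const_mul (2 * c)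
  have h34 : Integrable (fun t : ℝ => ‖(z - (t : ℂ))⁻¹‖ ^ 2 - 2 * c * ‖(z - (t : ℂ))⁻¹‖) ρ :=
    h3.sub h4
  rw [integral_add h34 (integrable_const _), integral_sub h3 h4, integral_const_mul,
    ← hc] at h2
  simp only [integral_const, probReal_univ, one_smul] at h2
  have h5 : ‖cauchyTransform ρ z‖ ^ 2 ≤ c ^ 2 := by gcongr
  linarith

lemma mul_cauchyTransform_sub_one_im [IsProbabilityMeasure ρ] {z : ℂ} (hz : 0 < z.im) :
    (z * cauchyTransform ρ z - 1).im = -(z.im * ∫ t : ℝ, t * ‖(z - (t : ℂ))⁻¹‖ ^ 2 ∂ρ) := by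
  rw [← integral_ofReal_mul_inv_sub_ofReal hz, ← integral_const_mul, ← integral_neg]
  have h : ∀ t : ℝ, -(z.im * (t * ‖(z - (t : ℂ))⁻¹‖ ^ 2)) = ((t : ℂ) * (z - (t : ℂ))⁻¹).im := by
    intro t
    rw [Complex.im_ofReal_mul, inv_sub_ofReal_im]
    ring
  simp_rw [h]
  exact (integral_im (integrable_ofReal_mul_inv_sub_ofReal hz)).symm

lemma integrable_mul_norm_inv_sub_ofReal_sq [IsFiniteMeasure ρ] {z : ℂ} (hz : 0 < z.im) :
    Integrable (fun t : ℝ => t * ‖(z - (t : ℂ))⁻¹‖ ^ 2) ρ := by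
  refine .of_bound
    (continuous_id.mul ((continuous_inv_sub_ofReal hz).norm.pow 2)).aestronglyMeasurable
    ((‖z‖ * z.im⁻¹ + 1) * z.im⁻¹) (.of_forall fun t => ?_)
  have h1 := norm_inv_sub_ofReal_le hz t
  have h2 := norm_ofReal_mul_inv_sub_ofReal_le hz t
  rw [norm_mul, Complex.norm_real] at h2
  rw [norm_mul, norm_pow, norm_norm, pow_two, ← mul_assoc]
  gcongr

/-- On `[0, ∞)`, either `z G(z) - 1` is in the open lower half-plane or it vanishes. -/
lemma mul_cauchyTransform_sub_one_im_neg_or_eq_zero [IsProbabilityMeasure ρ]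
    (hρ : ρ (Set.Iio 0) = 0) {z : ℂ} (hz : 0 < z.im) :
    (z * cauchyTransform ρ z - 1).im < 0 ∨ z * cauchyTransform ρ z - 1 = 0 := by
  have h0 := ae_nonneg_of_measure_Iio hρ
  have hn : 0 ≤ᵐ[ρ] fun t : ℝ => t * ‖(z - (t : ℂ))⁻¹‖ ^ 2 := by
    filter_upwards [h0] with t ht
    simp only [Pi.zero_apply]
    positivity
  rcases (integral_nonneg_of_ae hn).lt_or_eq with h | h
  · left
    rw [mul_cauchyTransform_sub_one_im hz, neg_lt_zero]
    exact mul_pos hz h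
  · right
    rw [← integral_ofReal_mul_inv_sub_ofReal hz]
    have := (integral_eq_zero_iff_of_nonneg_ae hn
      (integrable_mul_norm_inv_sub_ofReal_sq hz)).1 h.symm
    apply integral_eq_zero_of_ae
    filter_upwards [this] with t ht
    simpa [sub_ofReal_ne_zero hz t] using ht

lemma mul_cauchyTransform_sub_one_im_nonpos [IsProbabilityMeasure ρ]
    (hρ : ρ (Set.Iio 0) = 0) {z : ℂ} (hz : 0 < z.im) :
    (z * cauchyTransform ρ z - 1).im ≤ 0 := by
  rcases mul_cauchyTransform_sub_one_im_neg_or_eq_zero hρ hz with h | h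
  · exact h.le
  · simp [h]

end Resolvent

lemma boolean_mult_denominator_ne_zero
    {μ ν : Measure ℝ} [IsProbabilityMeasure μ] [IsProbabilityMeasure ν]
    (hν : ν (Set.Iio 0) = 0) {z : ℂ} (hz : 0 < z.im) :
    z * cauchyTransform μ z * cauchyTransform ν z
        - (z * cauchyTransform μ z - 1) * (z * cauchyTransform ν z - 1) ≠ 0 := by
  intro hD
  have hG := cauchyTransform_im_neg (ρ := μ) hz
  have hH := cauchyTransform_im_neg (ρ := ν) hz
  have hG2 := norm_cauchyTransform_sq_le (ρ := μ) hz
  have hGi := cauchyTransform_im (ρ := μ) hz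
  have hφ := mul_cauchyTransform_sub_one_im_neg_or_eq_zero hν hz
  set G := cauchyTransform μ z
  set H := cauchyTransform ν z
  have hG0 : G ≠ 0 := fun h => by simp [h] at hG
  have hH0 : H ≠ 0 := fun h => by simp [h] at hH
  have hz0 : z ≠ 0 := fun h => by simp [h] at hz
  set φ := z * H - 1 with hφd
  have ha : ((z * G - 1) * (starRingEnd ℂ) G).im ≤ 0 := by
    have : (z * G - 1) * (starRingEnd ℂ) G = z * ((‖G‖ ^ 2 : ℝ) : ℂ) - (starRingEnd ℂ) G := by
      rw [← Complex.normSq_eq_norm_sq, ← Complex.mul_conj]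
      ring
    rw [this, Complex.sub_im, Complex.im_mul_ofReal, Complex.conj_im, hGi]
    nlinarith
  have hab : ((z * G - 1) * (starRingEnd ℂ) G) * (φ * (starRingEnd ℂ) (z * H))
      = ((‖G‖ ^ 2 * ‖z * H‖ ^ 2 : ℝ) : ℂ) := by
    rw [← Complex.normSq_eq_norm_sq, ← Complex.normSq_eq_norm_sq, Complex.ofReal_mul,
      ← Complex.mul_conj, ← Complex.mul_conj]
    linear_combination -(starRingEnd ℂ) G * (starRingEnd ℂ) (z * H) * hD
  have hpos : 0 < ‖G‖ ^ 2 * ‖z * H‖ ^ 2 :=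
    mul_pos (pow_pos (norm_pos_iff.2 hG0) 2) (pow_pos (norm_pos_iff.2 (mul_ne_zero hz0 hH0)) 2)
  rcases hφ with h | h
  · have hb : (φ * (starRingEnd ℂ) (z * H)).im < 0 := by
      have : φ * (starRingEnd ℂ) (z * H) = (Complex.normSq φ : ℂ) + φ := by
        rw [← Complex.mul_conj, show z * H = φ + 1 by rw [hφd]; ring, map_add, map_one]
        ring
      rw [this]
      simpa using h
    set a := (z * G - 1) * (starRingEnd ℂ) G
    set b := φ * (starRingEnd ℂ) (z * H)
    have hab' : a * (Complex.normSq b : ℂ)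
        = ((‖G‖ ^ 2 * ‖z * H‖ ^ 2 : ℝ) : ℂ) * (starRingEnd ℂ) b := by
      rw [← hab, ← Complex.mul_conj]
      ring
    have := congrArg Complex.im hab'
    rw [Complex.im_mul_ofReal, Complex.im_ofReal_mul, Complex.conj_im] at this
    nlinarith [Complex.normSq_nonneg b]
  · rw [h, zero_mul, mul_zero, eq_comm, Complex.ofReal_eq_zero] at hab
    exact hpos.ne' hab

section Uniqueness

open ProbabilityTheory Filter Topology
open scoped NNReal

lemma charFun_cauchyMeasure_zero {γ : ℝ≥0} (hγ : γ ≠ 0) (t : ℝ) :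
    charFun (cauchyMeasure 0 γ) t = charFun (cauchyMeasure 0 1) (γ * t) := by
  have hγ' : (0 : ℝ) < γ := by positivity
  have key : ∀ (δ : ℝ≥0), δ ≠ 0 → ∀ s : ℝ, charFun (cauchyMeasure 0 δ) s
      = ∫ x : ℝ, cauchyPDFReal 0 δ x • Complex.exp (s * x * Complex.I) := by
    intro δ hδ s
    rw [charFun_apply_real, cauchyMeasure_of_scale_ne_zero 0 hδ,
      integral_withDensity_eq_integral_toReal_smul (by fun_prop)
        (.of_forall fun x => by simp [cauchyPDF])]
    refine integral_congr_ae (.of_forall fun x => ?_)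
    simp only [cauchyPDF_def]
    rw [ENNReal.toReal_ofReal (cauchyPDF_pos 0 hδ x).le]
  rw [key γ hγ, key 1 one_ne_zero]
  have := Measure.integral_comp_mul_left
    (fun x : ℝ => cauchyPDFReal 0 γ x • Complex.exp (t * x * Complex.I)) (γ : ℝ)
  rw [abs_of_pos (inv_pos.2 hγ'), eq_comm, inv_smul_eq_iff₀ hγ'.ne', ← integral_smul] at this
  rw [this]
  refine integral_congr_ae (.of_forall fun x => ?_)
  simp only [cauchyPDFReal_def', smul_smul]
  congr 1
  · simp only [sub_zero, NNReal.coe_one]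
    push_cast
    field_simp
  · push_cast
    ring_nf

lemma lintegral_cauchyPDF_sub {ρ : Measure ℝ} [IsFiniteMeasure ρ] {γ : ℝ≥0} (hγ : γ ≠ 0)
    (x : ℝ) : ∫⁻ t, cauchyPDF 0 γ (x - t) ∂ρ
      = ENNReal.ofReal (-(Real.pi⁻¹ * (cauchyTransform ρ (x + γ * Complex.I)).im)) := by
  have hz : 0 < ((x : ℂ) + γ * Complex.I).im := by simpa using pos_iff_ne_zero.2 hγ
  have h : ∀ t : ℝ, cauchyPDFReal 0 γ (x - t)
      = Real.pi⁻¹ * (γ * ‖((x : ℂ) + γ * Complex.I - t)⁻¹‖ ^ 2) := by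
    intro t
    rw [cauchyPDFReal_def, norm_inv, inv_pow, ← Complex.normSq_eq_norm_sq,
      Complex.normSq_apply]
    simp
    ring
  simp_rw [cauchyPDF_def, h]
  rw [← ofReal_integral_eq_lintegral_ofReal, integral_const_mul, integral_const_mul,
    cauchyTransform_im hz]
  · simp
  · exact ((integrable_norm_inv_sub_ofReal_sq hz).const_mul _).const_mul _
  · exact .of_forall fun t => by positivity

lemma conv_cauchyMeasure {ρ : Measure ℝ} [IsFiniteMeasure ρ] {γ : ℝ≥0} (hγ : γ ≠ 0) :
    ρ ∗ cauchyMeasure 0 γ = volume.withDensity fun x : ℝ =>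
      ENNReal.ofReal (-(Real.pi⁻¹ * (cauchyTransform ρ ((x : ℂ) + γ * Complex.I)).im)) := by
  have hm : Measurable (fun p : ℝ × ℝ => cauchyPDF 0 γ (p.2 - p.1)) :=
    (measurable_cauchyPDF 0 γ).comp (measurable_snd.sub measurable_fst)
  have hm' : Measurable fun x : ℝ => ∫⁻ t, cauchyPDF 0 γ (x - t) ∂ρ :=
    Measurable.lintegral_prod_left hm
  simp_rw [← lintegral_cauchyPDF_sub hγ]
  refine Measure.ext_of_lintegral _ fun f hf => ?_
  rw [Measure.lintegral_conv hf, cauchyMeasure_of_scale_ne_zero 0 hγ,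
    lintegral_withDensity_eq_lintegral_mul _ hm' hf]
  have h1 : ∀ t : ℝ, ∫⁻ s, f (t + s) ∂(volume.withDensity (cauchyPDF 0 γ))
      = ∫⁻ x, cauchyPDF 0 γ (x - t) * f x := by
    intro t
    rw [lintegral_withDensity_eq_lintegral_mul _ (by fun_prop) (by fun_prop),
      ← lintegral_add_left_eq_self (μ := volume) (fun x => cauchyPDF 0 γ (x - t) * f x) t]
    simp
  simp_rw [h1]
  rw [lintegral_lintegral_swap (hm.mul (hf.comp measurable_snd)).aemeasurable]
  refine lintegral_congr fun x => ?_
  simp only [Pi.mul_apply]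
  rw [lintegral_mul_const _ (by fun_prop)]

/-- A probability measure on `ℝ` is determined by its Cauchy transform on the upper half-plane. -/
lemma eq_of_cauchyTransform_eq {ρ σ : Measure ℝ} [IsProbabilityMeasure ρ]
    [IsProbabilityMeasure σ]
    (h : ∀ z : ℂ, 0 < z.im → cauchyTransform ρ z = cauchyTransform σ z) : ρ = σ := by
  refine Measure.ext_of_charFun (funext fun t => ?_)
  have hlim : Tendsto (fun γ : ℝ => charFun (cauchyMeasure 0 1) (γ * t)) (𝓝[>] 0) (𝓝 1) := by
    have hc : Continuous fun γ : ℝ => charFun (cauchyMeasure 0 1) (γ * t) :=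
      (continuous_charFun (μ := cauchyMeasure 0 1)).comp (continuous_id.mul continuous_const)
    have := hc.tendsto 0
    simp only [zero_mul, charFun_zero, probReal_univ, Complex.ofReal_one] at this
    exact this.mono_left nhdsWithin_le_nhds
  obtain ⟨γ, hγ1, hγ0⟩ := ((hlim.eventually_ne one_ne_zero).and self_mem_nhdsWithin).exists
  lift γ to ℝ≥0 using le_of_lt hγ0
  have hγ : γ ≠ 0 := by
    rintro rfl
    simp at hγ0
  rw [← charFun_cauchyMeasure_zero hγ] at hγ1
  have hconv : ρ ∗ cauchyMeasure 0 γ = σ ∗ cauchyMeasure 0 γ := by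
    rw [conv_cauchyMeasure hγ, conv_cauchyMeasure hγ]
    congr 1
    funext x
    rw [h]
    simpa using pos_iff_ne_zero.2 hγ
  have := congrFun (congrArg charFun hconv) t
  simp only [charFun_conv] at this
  exact mul_right_cancel₀ hγ1 this

end Uniqueness

section FiniteDimensional

open scoped InnerProductSpace Matrix ComplexOrder

/-- The spectral measure at a unit vector of a positive operator in finite dimension. -/
lemma LinearMap.IsPositive.exists_spectral_measure {E : Type*} [NormedAddCommGroup E]
    [InnerProductSpace ℂ E] [FiniteDimensional ℂ E] {T : E →ₗ[ℂ] E} (hT : T.IsPositive)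
    {w : E} (hw : ‖w‖ = 1) :
    ∃ l : Measure ℝ, IsProbabilityMeasure l ∧ l (Set.Iio 0) = 0 ∧
      ∀ z : ℂ, 0 < z.im → ∀ u : E, z • u - T u = w → cauchyTransform l z = ⟪w, u⟫_ℂ := by
  set b := hT.isSymmetric.eigenvectorBasis rfl
  set e := hT.isSymmetric.eigenvalues rfl
  have he : ∀ k, 0 ≤ e k := fun k => hT.nonneg_eigenvalues rfl k
  refine ⟨∑ k, ENNReal.ofReal (‖⟪b k, w⟫_ℂ‖ ^ 2) • Measure.dirac (e k), ⟨?_⟩, ?_, ?_⟩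
  · simp only [Measure.coe_finsetSum, Finset.sum_apply, Measure.smul_apply, measure_univ,
      smul_eq_mul, mul_one]
    rw [← ENNReal.ofReal_sum_of_nonneg (fun k _ => by positivity),
      b.sum_sq_norm_inner_right, hw]
    simp
  · simp [he]
  · intro z hz u hu
    have hk : ∀ k, ⟪b k, w⟫_ℂ = (z - (e k : ℂ)) * ⟪b k, u⟫_ℂ := by
      intro k
      rw [← hu, inner_sub_right, inner_smul_right, ← hT.isSymmetric,
        hT.isSymmetric.apply_eigenvectorBasis, inner_smul_left]
      simp [b, e, sub_mul]
    rw [cauchyTransform, integral_finsetSum_measure fun k _ =>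
      (integrable_inv_sub_ofReal hz).smul_measure ENNReal.ofReal_ne_top,
      ← b.sum_inner_mul_inner w u]
    refine Finset.sum_congr rfl fun k _ => ?_
    rw [integral_smul_measure, integral_dirac, ENNReal.toReal_ofReal (by positivity),
      ← inner_conj_symm w (b k), Complex.real_smul, ← Complex.normSq_eq_norm_sq,
      ← Complex.mul_conj, mul_comm ⟪b k, w⟫_ℂ, mul_assoc]
    congr 1
    rw [hk k]
    field_simp [sub_ofReal_ne_zero hz (e k)]

lemma Matrix.PosSemidef.exists_spectral_measure {n : Type*} [Fintype n] [DecidableEq n]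
    {M : Matrix n n ℂ} (hM : M.PosSemidef) {w : n → ℂ} (hw : w ⬝ᵥ star w = 1) :
    ∃ l : Measure ℝ, IsProbabilityMeasure l ∧ l (Set.Iio 0) = 0 ∧
      ∀ z : ℂ, 0 < z.im → ∀ u : n → ℂ, z • u - M *ᵥ u = w →
        cauchyTransform l z = u ⬝ᵥ star w := by
  have hT : (Matrix.toEuclideanLin M).IsPositive := Matrix.isPositive_toEuclideanLin_iff.2 hM
  have hw' : ‖(WithLp.toLp 2 w : EuclideanSpace ℂ n)‖ = 1 := by
    rw [norm_eq_sqrt_re_inner (𝕜 := ℂ), EuclideanSpace.inner_toLp_toLp, hw]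
    simp
  obtain ⟨l, h1, h2, h3⟩ := hT.exists_spectral_measure hw'
  refine ⟨l, h1, h2, fun z hz u hu => ?_⟩
  rw [h3 z hz (WithLp.toLp 2 u) ?_, EuclideanSpace.inner_toLp_toLp]
  rw [← hu]
  rfl

variable {ι κ : Type*} [Fintype κ] [DecidableEq κ]

/-- For an isometry `V` and a nonnegative diagonal matrix `y`, the extension `1 + V (y - 1) Vᴴ` of
`y` by the identity is positive semidefinite. -/
lemma posSemidef_one_add_isometry_conj {m : Type*} [Fintype m] [DecidableEq m]
    {V : Matrix m κ ℂ} (hV : Vᴴ * V = 1) {y : κ → ℝ} (hy : ∀ j, 0 ≤ y j) :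
    (1 + V * (Matrix.diagonal (fun j => (y j : ℂ)) - 1) * Vᴴ).PosSemidef := by
  have h1 : ((1 - V * Vᴴ)ᴴ * (1 - V * Vᴴ)).PosSemidef :=
    Matrix.posSemidef_conjTranspose_mul_self _
  have h2 : (V * Matrix.diagonal (fun j => (y j : ℂ)) * Vᴴ).PosSemidef :=
    (Matrix.PosSemidef.diagonal fun j => by simpa using hy j).mul_mul_conjTranspose_same V
  convert h1.add h2 using 1
  have h3 : V * Vᴴ * (V * Vᴴ) = V * Vᴴ := by
    rw [Matrix.mul_assoc, ← Matrix.mul_assoc Vᴴ, hV, Matrix.one_mul]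
  simp only [Matrix.conjTranspose_sub, Matrix.conjTranspose_one, Matrix.conjTranspose_mul,
    Matrix.conjTranspose_conjTranspose, Matrix.mul_sub, Matrix.sub_mul, Matrix.mul_one,
    Matrix.one_mul, h3]
  abel

/-- The isometry embedding `ℂ^κ` into `ℂ^ι ⊕ ℂ^κ` which sends the unit vector `r` to `(s, 0)` and
fixes the orthogonal complement of `r`. -/
def booleanEmbedding (s : ι → ℝ) (r : κ → ℝ) : Matrix (ι ⊕ κ) κ ℂ :=
  Matrix.of fun k j => Sum.elim (fun i => (s i * r j : ℂ))
    (fun l => (if l = j then 1 else 0) - (r l * r j : ℂ)) k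

lemma booleanEmbedding_mulVec (s : ι → ℝ) (r : κ → ℝ) (v : κ → ℂ) :
    booleanEmbedding s r *ᵥ v = Sum.elim (fun i => s i * ∑ j, r j * v j)
      (fun l => v l - r l * ∑ j, r j * v j) := by
  ext (i | l)
  · simp [booleanEmbedding, Matrix.mulVec, dotProduct, Finset.mul_sum, mul_assoc]
  · simp [booleanEmbedding, Matrix.mulVec, dotProduct, Finset.mul_sum, mul_assoc, sub_mul,
      Finset.sum_sub_distrib]

variable [Fintype ι]

lemma booleanEmbedding_conjTranspose_mul_self {s : ι → ℝ} {r : κ → ℝ}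
    (hs : ∑ i, s i ^ 2 = 1) (hr : ∑ j, r j ^ 2 = 1) :
    (booleanEmbedding s r)ᴴ * booleanEmbedding s r = 1 := by
  have hs' : ∑ i, (s i : ℂ) ^ 2 = 1 := by exact_mod_cast hs
  have hr' : ∑ j, (r j : ℂ) ^ 2 = 1 := by exact_mod_cast hr
  ext j k
  have h1 : ∑ i, ((s i : ℂ) * r j) * (s i * r k) = r j * r k := by
    rw [← one_mul (r j * r k : ℂ), ← hs', Finset.sum_mul]
    exact Finset.sum_congr rfl fun i _ => by ring
  have h2 : ∑ l, ((if l = j then (1 : ℂ) else 0) - r l * r j)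
      * ((if l = k then 1 else 0) - r l * r k) = (if j = k then 1 else 0) - r j * r k := by
    have : ∑ l, (r l : ℂ) ^ 2 * (r j * r k) = r j * r k := by
      rw [← Finset.sum_mul, hr', one_mul]
    calc _ = ∑ l, ((if l = j then (if l = k then (1 : ℂ) else 0) - r l * r k else 0)
          - (if l = k then (r l * r j : ℂ) else 0) + (r l : ℂ) ^ 2 * (r j * r k)) :=
          Finset.sum_congr rfl fun l _ => by split_ifs <;> ring
      _ = _ := by
        rw [Finset.sum_add_distrib, Finset.sum_sub_distrib, this]
        simp
        ring
  simp only [Matrix.mul_apply, Matrix.conjTranspose_apply, booleanEmbedding, Matrix.of_apply,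
    Fintype.sum_sum_type, Sum.elim_inl, Sum.elim_inr, Matrix.one_apply]
  simp only [RCLike.star_def, map_sub, map_mul, apply_ite (starRingEnd ℂ), map_one, map_zero,
    Complex.conj_ofReal, h1, h2]
  ring

lemma booleanEmbedding_conjTranspose_mulVec (s : ι → ℝ) (r : κ → ℝ) (c : ι → ℂ) (d : κ → ℂ) :
    (booleanEmbedding s r)ᴴ *ᵥ Sum.elim c d =
      fun j => d j + r j * (∑ i, s i * c i - ∑ l, r l * d l) := by
  ext j
  simp only [booleanEmbedding, Matrix.mulVec, dotProduct, Fintype.sum_sum_type,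
    Matrix.conjTranspose_apply, Matrix.of_apply, Sum.elim_inl, Sum.elim_inr, RCLike.star_def,
    map_sub, map_mul, apply_ite (starRingEnd ℂ), map_one, map_zero, Complex.conj_ofReal, sub_mul,
    ite_mul, one_mul, zero_mul, Finset.sum_sub_distrib, Finset.sum_ite_eq', Finset.mem_univ, if_true,
    mul_sub, Finset.mul_sum]
  have h1 : ∑ i, (s i : ℂ) * r j * c i = ∑ i, (r j : ℂ) * (s i * c i) :=
    Finset.sum_congr rfl fun i _ => by ring
  have h2 : ∑ i, (r i : ℂ) * r j * d i = ∑ i, (r j : ℂ) * (r i * d i) :=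
    Finset.sum_congr rfl fun i _ => by ring
  rw [h1, h2]
  ring

/-- The multiplicative boolean convolution of finitely supported measures, realised as a
spectral measure of `√X Y √X`. -/
lemma exists_boolean_mult_convolution_of_finite [DecidableEq ι] {s : ι → ℝ} {r : κ → ℝ}
    (hs : ∑ i, s i ^ 2 = 1) (hr : ∑ j, r j ^ 2 = 1) {x : ι → ℝ} {y : κ → ℝ}
    (hx : ∀ i, 0 ≤ x i) (hy : ∀ j, 0 ≤ y j) :
    ∃ l : Measure ℝ, IsProbabilityMeasure l ∧ l (Set.Iio 0) = 0 ∧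
      ∀ z : ℂ, 0 < z.im → ∀ G W H : ℂ, ∑ i, (s i : ℂ) ^ 2 * (z - x i)⁻¹ = G →
        ∑ i, (s i : ℂ) ^ 2 * (Real.sqrt (x i) / (z - x i)) = W →
        ∑ j, (r j : ℂ) ^ 2 * (z - y j)⁻¹ = H →
        z * G * H - (z * G - 1) * (z * H - 1) ≠ 0 →
        cauchyTransform l z = G + W ^ 2 * ((z - 1) * H - 1) /
          (z * G * H - (z * G - 1) * (z * H - 1)) := by
  have hs' : ∑ i, (s i : ℂ) ^ 2 = 1 := by exact_mod_cast hs
  have hr' : ∑ j, (r j : ℂ) ^ 2 = 1 := by exact_mod_cast hr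
  set V := booleanEmbedding s r
  set A : Matrix (ι ⊕ κ) (ι ⊕ κ) ℂ :=
    Matrix.diagonal (Sum.elim (fun i => (Real.sqrt (x i) : ℂ)) fun _ => 1) with hA
  set Y : Matrix (ι ⊕ κ) (ι ⊕ κ) ℂ :=
    1 + V * (Matrix.diagonal (fun j => (y j : ℂ)) - 1) * Vᴴ with hY
  have hAH : Aᴴ = A := by
    rw [hA, Matrix.diagonal_conjTranspose]
    congr 1
    ext (i | j) <;> simp
  have hM : (Aᴴ * Y * A).PosSemidef :=
    (posSemidef_one_add_isometry_conj (booleanEmbedding_conjTranspose_mul_self hs hr)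
      hy).conjTranspose_mul_mul_same A
  rw [hAH] at hM
  have hw : (Sum.elim (fun i => (s i : ℂ)) (0 : κ → ℂ)) ⬝ᵥ
      star (Sum.elim (fun i => (s i : ℂ)) (0 : κ → ℂ)) = 1 := by
    simp [dotProduct, Fintype.sum_sum_type, ← pow_two, hs']
  obtain ⟨l, hl1, hl2, hl3⟩ := hM.exists_spectral_measure hw
  refine ⟨l, hl1, hl2, fun z hz G W H hG hW hH hD => ?_⟩
  have hzx : ∀ i, z - (x i : ℂ) ≠ 0 := fun i => sub_ofReal_ne_zero hz _
  have hzy : ∀ j, z - (y j : ℂ) ≠ 0 := fun j => sub_ofReal_ne_zero hz _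
  set D := z * G * H - (z * G - 1) * (z * H - 1)
  set a := ((z - 1) * H - 1) * W / D with ha
  set σ := W + a * (z * G - 1) with hσ
  have haD : a * D = ((z - 1) * H - 1) * W := by
    rw [ha]
    field_simp
  have hsqrt : ∀ i, (Real.sqrt (x i) : ℂ) * Real.sqrt (x i) = x i := fun i => by
    rw [← Complex.ofReal_mul, Real.mul_self_sqrt (hx i)]
  have hψ : ∑ i, (s i : ℂ) ^ 2 * (x i * (z - x i)⁻¹) = z * G - 1 := by
    rw [← hG, ← hs', Finset.mul_sum, ← Finset.sum_sub_distrib]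
    refine Finset.sum_congr rfl fun i _ => ?_
    rw [ofReal_mul_inv_sub_ofReal hz]
    ring
  have hφ : ∑ j, (r j : ℂ) ^ 2 * (y j * (z - y j)⁻¹) = z * H - 1 := by
    rw [← hH, ← hr', Finset.mul_sum, ← Finset.sum_sub_distrib]
    refine Finset.sum_congr rfl fun i _ => ?_
    rw [ofReal_mul_inv_sub_ofReal hz]
    ring
  set u₁ : ι → ℂ := fun i => s i * ((1 + a * Real.sqrt (x i)) * (z - x i)⁻¹) with hu₁
  set u₂ : κ → ℂ := fun j => r j * (((y j - 1) * σ - a) * (z - y j)⁻¹) with hu₂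
  have hsu : ∑ i, s i * u₁ i = G + a * W := by
    rw [← hG, ← hW, Finset.mul_sum, ← Finset.sum_add_distrib]
    refine Finset.sum_congr rfl fun i _ => ?_
    simp only [hu₁, div_eq_mul_inv]
    ring
  have hsc : ∑ i, s i * (Real.sqrt (x i) * u₁ i) = σ := by
    rw [hσ, ← hψ, ← hW, Finset.mul_sum, ← Finset.sum_add_distrib]
    refine Finset.sum_congr rfl fun i _ => ?_
    simp only [hu₁, div_eq_mul_inv, ← hsqrt]
    ring
  have hru : ∑ j, r j * u₂ j = 0 := by
    have : ∑ j, r j * u₂ j = σ * (z * H - 1) - (σ + a) * H := by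
      rw [← hφ, ← hH, Finset.mul_sum, Finset.mul_sum, ← Finset.sum_sub_distrib]
      refine Finset.sum_congr rfl fun i _ => ?_
      simp only [hu₂]
      ring
    rw [this, hσ]
    linear_combination -haD
  have hrw : ∑ j, r j * ((y j - 1) * (u₂ j + r j * σ)) = a := by
    have : ∑ j, r j * ((y j - 1) * (u₂ j + r j * σ))
        = (z - 1) * ∑ j, r j * u₂ j + a * ∑ j, (r j : ℂ) ^ 2 := by
      rw [Finset.mul_sum, Finset.mul_sum, ← Finset.sum_add_distrib]
      refine Finset.sum_congr rfl fun j _ => ?_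
      have := hzy j
      simp only [hu₂]
      field_simp
      ring
    rw [this, hru, hr']
    ring
  have hAmul : ∀ (c : ι → ℂ) (d : κ → ℂ), A *ᵥ Sum.elim c d
      = Sum.elim (fun i => Real.sqrt (x i) * c i) d := by
    intro c d
    ext (i | j) <;> simp [hA, Matrix.mulVec_diagonal]
  have hsol : z • Sum.elim u₁ u₂ - (A * Y * A) *ᵥ Sum.elim u₁ u₂
      = Sum.elim (fun i => (s i : ℂ)) (0 : κ → ℂ) := by
    rw [← Matrix.mulVec_mulVec, ← Matrix.mulVec_mulVec, hAmul, hY, Matrix.add_mulVec,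
      Matrix.one_mulVec, ← Matrix.mulVec_mulVec, ← Matrix.mulVec_mulVec,
      booleanEmbedding_conjTranspose_mulVec, hsc, hru, sub_zero, Matrix.sub_mulVec,
      Matrix.one_mulVec]
    have hw' : Matrix.diagonal (fun j => (y j : ℂ)) *ᵥ (fun j => u₂ j + r j * σ)
        - (fun j => u₂ j + r j * σ) = fun j => (y j - 1) * (u₂ j + r j * σ) := by
      ext j
      simp [Matrix.mulVec_diagonal]
      ring
    rw [hw', booleanEmbedding_mulVec, hrw, Matrix.mulVec_add, hAmul, hAmul]
    ext (i | j)
    · have := hzx i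
      simp only [Pi.sub_apply, Pi.add_apply, Pi.smul_apply, Sum.elim_inl, smul_eq_mul,
        ← mul_assoc, hsqrt, hu₁]
      field_simp
      ring
    · have := hzy j
      simp only [Pi.sub_apply, Pi.add_apply, Pi.smul_apply, Sum.elim_inr, smul_eq_mul,
        Pi.zero_apply, hu₂]
      field_simp
      ring
  rw [hl3 z hz _ hsol]
  have : (Sum.elim u₁ u₂) ⬝ᵥ star (Sum.elim (fun i => (s i : ℂ)) (0 : κ → ℂ))
      = ∑ i, s i * u₁ i := by
    simp [dotProduct, Fintype.sum_sum_type, mul_comm]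
  rw [this, hsu, ha]
  ring

end FiniteDimensional

section Approximation

open Filter Topology
open scoped BoundedContinuousFunction

lemma integral_map_simpleFunc {ρ : Measure ℝ} [IsFiniteMeasure ρ] (f : SimpleFunc ℝ ℝ)
    {h : ℝ → ℂ} (hh : Continuous h) :
    ∫ t, h t ∂(ρ.map f) = ∑ i : f.range,
      ((Real.sqrt (ρ.real (f ⁻¹' {(i : ℝ)})) : ℝ) : ℂ) ^ 2 * h i := by
  rw [integral_map f.measurable.aemeasurable hh.aestronglyMeasurable]
  have hms : ∀ i : f.range, MeasurableSet (f ⁻¹' {(i : ℝ)}) := fun i =>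
    f.measurableSet_preimage _
  have h1 : ∀ t, h (f t) = ∑ i : f.range, (f ⁻¹' {(i : ℝ)}).indicator (fun _ => h i) t := by
    intro t
    rw [Finset.sum_eq_single_of_mem (⟨f t, SimpleFunc.mem_range_self f t⟩ : f.range)
      (Finset.mem_univ _)]
    · simp
    · intro i _ hi
      refine Set.indicator_of_notMem (fun ht => hi (Subtype.ext ?_)) _
      exact (Set.mem_singleton_iff.1 ht).symm
  simp_rw [h1]
  rw [integral_finsetSum _ fun i _ => (integrable_const _).indicator (hms i)]
  refine Finset.sum_congr rfl fun i _ => ?_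
  rw [integral_indicator_const _ (hms i), ← Complex.ofReal_pow,
    Real.sq_sqrt measureReal_nonneg, Complex.real_smul]

lemma sum_sq_sqrt_preimage_simpleFunc {ρ : Measure ℝ} [IsProbabilityMeasure ρ]
    (f : SimpleFunc ℝ ℝ) :
    ∑ i : f.range, Real.sqrt (ρ.real (f ⁻¹' {(i : ℝ)})) ^ 2 = 1 := by
  have h := integral_map_simpleFunc (ρ := ρ) f (h := fun _ => 1) continuous_const
  have : IsProbabilityMeasure (ρ.map f) :=
    Measure.isProbabilityMeasure_map f.measurable.aemeasurable
  simp only [integral_const, probReal_univ, one_smul, mul_one] at h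
  exact_mod_cast h.symm

lemma exists_boolean_mult_convolution_of_simpleFunc (μ ν : Measure ℝ) [IsProbabilityMeasure μ]
    [IsProbabilityMeasure ν] {f g : SimpleFunc ℝ ℝ} (hf : ∀ t, 0 ≤ f t) (hg : ∀ t, 0 ≤ g t) :
    ∃ l : Measure ℝ, IsProbabilityMeasure l ∧ l (Set.Iio 0) = 0 ∧
      ∀ z : ℂ, 0 < z.im →
        cauchyTransform l z
          = cauchyTransform (μ.map f) z
            + (sqrtCauchyTransform (μ.map f) z) ^ 2 * ((z - 1) * cauchyTransform (ν.map g) z - 1) /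
                (z * cauchyTransform (μ.map f) z * cauchyTransform (ν.map g) z
                  - (z * cauchyTransform (μ.map f) z - 1)
                    * (z * cauchyTransform (ν.map g) z - 1)) := by
  have : IsProbabilityMeasure (μ.map f) :=
    Measure.isProbabilityMeasure_map f.measurable.aemeasurable
  have : IsProbabilityMeasure (ν.map g) :=
    Measure.isProbabilityMeasure_map g.measurable.aemeasurable
  have hν : (ν.map g) (Set.Iio 0) = 0 := by
    rw [Measure.map_apply g.measurable measurableSet_Iio]
    convert measure_empty (μ := ν)
    ext t
    simp [hg t]
  obtain ⟨l, h1, h2, h3⟩ := exists_boolean_mult_convolution_of_finite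
    (sum_sq_sqrt_preimage_simpleFunc (ρ := μ) f) (sum_sq_sqrt_preimage_simpleFunc (ρ := ν) g)
    (x := fun i => (i : ℝ)) (y := fun j => (j : ℝ))
    (fun i => by obtain ⟨t, ht⟩ := SimpleFunc.mem_range.1 i.2; exact ht ▸ hf t)
    (fun j => by obtain ⟨t, ht⟩ := SimpleFunc.mem_range.1 j.2; exact ht ▸ hg t)
  exact ⟨l, h1, h2, fun z hz => h3 z hz _ _ _
    (integral_map_simpleFunc f (continuous_inv_sub_ofReal hz)).symm
    (integral_map_simpleFunc f (continuous_sqrt_div_sub_ofReal hz)).symm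
    (integral_map_simpleFunc g (continuous_inv_sub_ofReal hz)).symm
    (boolean_mult_denominator_ne_zero hν hz)⟩

/-- Simple functions `ℝ → [0, ∞)` converging pointwise to the identity on `[0, ∞)`. -/
noncomputable def nonnegApprox (n : ℕ) : SimpleFunc ℝ ℝ :=
  SimpleFunc.approxOn id measurable_id (Set.Ici 0) 0 Set.self_mem_Ici n

lemma nonnegApprox_nonneg (n : ℕ) (t : ℝ) : 0 ≤ nonnegApprox n t :=
  SimpleFunc.approxOn_mem measurable_id Set.self_mem_Ici n t

lemma tendsto_nonnegApprox {t : ℝ} (ht : 0 ≤ t) :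
    Tendsto (fun n => nonnegApprox n t) atTop (𝓝 t) :=
  SimpleFunc.tendsto_approxOn measurable_id Set.self_mem_Ici (subset_closure ht)

lemma tendsto_integral_map_nonnegApprox {ρ : Measure ℝ} [IsFiniteMeasure ρ]
    (hρ : ρ (Set.Iio 0) = 0) {h : ℝ → ℂ} (hh : Continuous h) {C : ℝ} (hC : ∀ t, ‖h t‖ ≤ C) :
    Tendsto (fun n => ∫ t, h t ∂(ρ.map (nonnegApprox n))) atTop (𝓝 (∫ t, h t ∂ρ)) := by
  simp_rw [fun n => integral_map (nonnegApprox n).measurable.aemeasurable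
    (hh.aestronglyMeasurable (μ := ρ.map (nonnegApprox n)))]
  refine tendsto_integral_of_dominated_convergence (fun _ => C)
    (fun n => (hh.measurable.comp (nonnegApprox n).measurable).aestronglyMeasurable)
    (integrable_const C) (fun n => .of_forall fun t => hC _) ?_
  filter_upwards [ae_nonneg_of_measure_Iio hρ] with t ht
  exact (hh.tendsto t).comp (tendsto_nonnegApprox ht)

lemma measureReal_norm_gt_le {ρ : Measure ℝ} [IsProbabilityMeasure ρ] {y : ℝ} (hy : 0 < y) :
    ρ.real {t | y < ‖t‖}
      ≤ 2 * ‖1 - (y * Complex.I) * cauchyTransform ρ (y * Complex.I)‖ := by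
  have hz : 0 < ((y : ℂ) * Complex.I).im := by simpa using hy
  set z : ℂ := y * Complex.I with hzdef
  have hint := integrable_ofReal_mul_inv_sub_ofReal (ρ := ρ) hz
  have hms : MeasurableSet {t : ℝ | y < ‖t‖} := measurableSet_lt measurable_const measurable_norm
  have hre : ∀ t : ℝ, (-((t : ℂ) * (z - t)⁻¹)).re = t ^ 2 / (t ^ 2 + y ^ 2) := by
    intro t
    rw [Complex.neg_re, Complex.re_ofReal_mul, Complex.inv_re, Complex.normSq_apply]
    simp [hzdef]
    ring
  calc ρ.real {t | y < ‖t‖} = ∫ t, {t : ℝ | y < ‖t‖}.indicator 1 t ∂ρ :=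
        (integral_indicator_one hms).symm
    _ ≤ ∫ t : ℝ, 2 * (-((t : ℂ) * (z - t)⁻¹)).re ∂ρ := by
        refine integral_mono ((integrable_const 1).indicator hms)
          (hint.neg.re.const_mul 2) fun t => ?_
        simp only [hre]
        by_cases ht : t ∈ {t : ℝ | y < ‖t‖}
        · rw [Set.indicator_of_mem ht, Pi.one_apply, mul_div_assoc', le_div_iff₀ (by positivity)]
          have h1 : y < |t| := ht
          have := sq_abs t
          nlinarith
        · rw [Set.indicator_of_notMem ht]
          positivity
    _ = 2 * (1 - z * cauchyTransform ρ z).re := by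
        rw [integral_const_mul]
        congr 1
        rw [← neg_sub, ← integral_ofReal_mul_inv_sub_ofReal hz, ← integral_neg]
        exact integral_re hint.neg
    _ ≤ _ := by
        gcongr
        exact Complex.re_le_norm _

/-- A pointwise limit `F` of Cauchy transforms with `z F(z) → 1` along the imaginary axis is the
Cauchy transform of a probability measure. -/
lemma exists_cauchyTransform_eq_of_tendsto {l : ℕ → Measure ℝ}
    [∀ n, IsProbabilityMeasure (l n)] (hl : ∀ n, l n (Set.Iio 0) = 0) {F : ℂ → ℂ}
    (hlF : ∀ z : ℂ, 0 < z.im → Tendsto (fun n => cauchyTransform (l n) z) atTop (𝓝 (F z)))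
    (hF : Tendsto (fun y : ℝ => (y * Complex.I) * F (y * Complex.I)) atTop (𝓝 1)) :
    ∃ ρ : Measure ℝ, IsProbabilityMeasure ρ ∧ ρ (Set.Iio 0) = 0 ∧
      ∀ z : ℂ, 0 < z.im → cauchyTransform ρ z = F z := by
  have htight : IsTightMeasureSet (Set.range l) := by
    refine isTightMeasureSet_range_of_tendsto_limsup_measure_norm_gt ?_
    have hlim : Tendsto (fun y : ℝ => ENNReal.ofReal
        (2 * ‖1 - (y * Complex.I) * F (y * Complex.I)‖)) atTop (𝓝 0) := by
      have := ENNReal.tendsto_ofReal ((tendsto_const_nhds (x := (1 : ℂ)).sub hF).norm.const_mul 2)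
      simpa using this
    refine tendsto_of_tendsto_of_tendsto_of_le_of_le' tendsto_const_nhds hlim
      (.of_forall fun _ => zero_le) ?_
    filter_upwards [eventually_gt_atTop 0] with y hy
    have hz : 0 < ((y : ℂ) * Complex.I).im := by simpa using hy
    have hn := ENNReal.tendsto_ofReal ((tendsto_const_nhds (x := (1 : ℂ)).sub
      ((hlF _ hz).const_mul ((y : ℂ) * Complex.I))).norm.const_mul 2)
    rw [← hn.limsup_eq]
    refine limsup_le_limsup (.of_forall fun n => ?_)
    change l n {x | y < ‖x‖} ≤ _
    rw [← ofReal_measureReal]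
    exact ENNReal.ofReal_le_ofReal (measureReal_norm_gt_le hy)
  let P : ℕ → ProbabilityMeasure ℝ := fun n => ⟨l n, inferInstance⟩
  have hcomp : IsCompact (closure (Set.range P)) := by
    refine isCompact_closure_of_isTightMeasureSet (htight.subset ?_)
    rintro _ ⟨_, ⟨n, rfl⟩, rfl⟩
    exact ⟨n, rfl⟩
  obtain ⟨ρ, -, hρ⟩ := hcomp.ultrafilter_le_nhds ((hyperfilter ℕ).map P)
    (le_principal_iff.2 (mem_map.2 (univ_mem' fun n => subset_closure ⟨n, rfl⟩)))
  have hPρ : Tendsto P (hyperfilter ℕ : Filter ℕ) (𝓝 ρ) := hρ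
  have hle : (hyperfilter ℕ : Filter ℕ) ≤ atTop := Nat.hyperfilter_le_atTop
  refine ⟨ρ, inferInstance, ?_, fun z hz => ?_⟩
  · have := ProbabilityMeasure.le_liminf_measure_open_of_tendsto hPρ (isOpen_Iio (a := (0 : ℝ)))
    have h0 : ∀ n, (P n : Measure ℝ) (Set.Iio 0) = 0 := hl
    simpa [h0] using this
  · let h : ℝ →ᵇ ℂ := BoundedContinuousFunction.ofNormedAddCommGroup
      (fun t : ℝ => (z - (t : ℂ))⁻¹) (continuous_inv_sub_ofReal hz) z.im⁻¹
      (norm_inv_sub_ofReal_le hz)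
    have h1 := (ProbabilityMeasure.tendsto_iff_forall_integral_rclike_tendsto ℂ).1 hPρ h
    exact tendsto_nhds_unique h1 ((hlF z hz).mono_left hle)

end Approximation

section Asymptotics

open Filter Topology

variable {ρ : Measure ℝ}

lemma ofReal_mul_I_im_pos {y : ℝ} (hy : 0 < y) : 0 < ((y : ℂ) * Complex.I).im := by
  simpa using hy

lemma norm_inv_mul_I_sub_sq {y : ℝ} (t : ℝ) :
    ‖((y : ℂ) * Complex.I - t)⁻¹‖ ^ 2 = (t ^ 2 + y ^ 2)⁻¹ := by
  rw [norm_inv, inv_pow, ← Complex.normSq_eq_norm_sq, Complex.normSq_apply]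
  simp
  ring

lemma ofReal_mul_inv_mul_I_sub_re {y : ℝ} (t : ℝ) :
    ((t : ℂ) * ((y : ℂ) * Complex.I - t)⁻¹).re = -(t ^ 2 * (t ^ 2 + y ^ 2)⁻¹) := by
  rw [Complex.re_ofReal_mul, Complex.inv_re, Complex.normSq_apply]
  simp
  ring

lemma ofReal_mul_inv_mul_I_sub_im {y : ℝ} (t : ℝ) :
    ((t : ℂ) * ((y : ℂ) * Complex.I - t)⁻¹).im = -(y * t * (t ^ 2 + y ^ 2)⁻¹) := by
  rw [Complex.im_ofReal_mul, Complex.inv_im, Complex.normSq_apply]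
  simp
  ring

lemma mul_I_mul_cauchyTransform_sub_one_re_nonpos [IsProbabilityMeasure ρ] {y : ℝ}
    (hy : 0 < y) :
    ((y * Complex.I) * cauchyTransform ρ (y * Complex.I) - 1).re ≤ 0 := by
  have hz := ofReal_mul_I_im_pos hy
  rw [← integral_ofReal_mul_inv_sub_ofReal hz]
  refine (integral_re (integrable_ofReal_mul_inv_sub_ofReal hz)).symm.trans_le ?_
  refine integral_nonpos fun t => ?_
  change ((t : ℂ) * ((y : ℂ) * Complex.I - t)⁻¹).re ≤ 0
  rw [ofReal_mul_inv_mul_I_sub_re, neg_nonpos]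
  positivity

lemma norm_inv_mul_I_sub_le {y : ℝ} (hy : 0 < y) (t : ℝ) :
    ‖((y : ℂ) * Complex.I - t)⁻¹‖ ≤ y⁻¹ := by
  simpa using norm_inv_sub_ofReal_le (ofReal_mul_I_im_pos hy) t

lemma tendsto_mul_I_mul_cauchyTransform_sub_one [IsProbabilityMeasure ρ] :
    Tendsto (fun y : ℝ => (y * Complex.I) * cauchyTransform ρ (y * Complex.I) - 1) atTop
      (𝓝 0) := by
  have h : Tendsto (fun y : ℝ => ∫ t : ℝ, (t : ℂ) * ((y : ℂ) * Complex.I - t)⁻¹ ∂ρ) atTop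
      (𝓝 (∫ _, (0 : ℂ) ∂ρ)) := by
    refine tendsto_integral_filter_of_dominated_convergence (fun _ => 1) ?_ ?_
      (integrable_const _) (.of_forall fun t => ?_)
    · filter_upwards [eventually_gt_atTop 0] with y hy
      exact (integrable_ofReal_mul_inv_sub_ofReal (ofReal_mul_I_im_pos hy)).aestronglyMeasurable
    · filter_upwards [eventually_gt_atTop 0] with y hy
      refine .of_forall fun t => ?_
      rw [← sq_le_sq₀ (norm_nonneg _) zero_le_one, norm_mul, mul_pow, norm_inv_mul_I_sub_sq,
        Complex.norm_real, Real.norm_eq_abs, sq_abs, one_pow, ← div_eq_mul_inv,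
        div_le_one (by positivity)]
      nlinarith
    · rw [tendsto_zero_iff_norm_tendsto_zero]
      have : Tendsto (fun y : ℝ => ‖(t : ℂ)‖ * y⁻¹) atTop (𝓝 0) := by
        simpa using tendsto_inv_atTop_zero.const_mul ‖(t : ℂ)‖
      refine tendsto_of_tendsto_of_tendsto_of_le_of_le' tendsto_const_nhds this
        (.of_forall fun y => norm_nonneg _) ?_
      filter_upwards [eventually_gt_atTop 0] with y hy
      rw [norm_mul]
      gcongr
      exact norm_inv_mul_I_sub_le hy t
  rw [integral_zero] at h
  refine h.congr' ?_
  filter_upwards [eventually_gt_atTop 0] with y hy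
  exact integral_ofReal_mul_inv_sub_ofReal (ofReal_mul_I_im_pos hy)

lemma integral_mul_norm_inv_le [IsProbabilityMeasure ρ] (hρ : ρ (Set.Iio 0) = 0) {y : ℝ}
    (hy : 0 < y) :
    ∫ t : ℝ, ‖(t : ℂ) * ((y : ℂ) * Complex.I - t)⁻¹‖ ∂ρ
      ≤ 2 * ‖(y * Complex.I) * cauchyTransform ρ (y * Complex.I) - 1‖ := by
  have hz := ofReal_mul_I_im_pos hy
  have hint := integrable_ofReal_mul_inv_sub_ofReal (ρ := ρ) hz
  set ψ := (y * Complex.I) * cauchyTransform ρ (y * Complex.I) - 1 with hψ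
  have hre : ∫ t : ℝ, ((t : ℂ) * ((y : ℂ) * Complex.I - t)⁻¹).re ∂ρ = ψ.re := by
    rw [hψ, ← integral_ofReal_mul_inv_sub_ofReal hz]
    exact integral_re hint
  have him : ∫ t : ℝ, ((t : ℂ) * ((y : ℂ) * Complex.I - t)⁻¹).im ∂ρ = ψ.im := by
    rw [hψ, ← integral_ofReal_mul_inv_sub_ofReal hz]
    exact integral_im hint
  calc _ ≤ ∫ t : ℝ, (-((t : ℂ) * ((y : ℂ) * Complex.I - t)⁻¹).re
        - ((t : ℂ) * ((y : ℂ) * Complex.I - t)⁻¹).im) ∂ρ := by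
        refine integral_mono_ae hint.norm (hint.re.neg.sub hint.im) ?_
        filter_upwards [ae_nonneg_of_measure_Iio hρ] with t ht
        refine (Complex.norm_le_abs_re_add_abs_im _).trans_eq ?_
        rw [abs_of_nonpos, abs_of_nonpos]
        · rfl
        · rw [ofReal_mul_inv_mul_I_sub_im, neg_nonpos]
          positivity
        · rw [ofReal_mul_inv_mul_I_sub_re, neg_nonpos]
          positivity
    _ = -ψ.re - ψ.im := by
        rw [← hre, ← him, ← integral_neg]
        exact integral_sub hint.re.neg hint.im
    _ ≤ _ := by
        have h1 := neg_le_of_abs_le (Complex.abs_re_le_norm ψ)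
        have h2 := neg_le_of_abs_le (Complex.abs_im_le_norm ψ)
        linarith

/-- Cauchy-Schwarz bound for `W(iy)`, with the mass beyond `K` split off. -/
lemma mul_norm_sqrtCauchyTransform_sq_le [IsProbabilityMeasure ρ] (hρ : ρ (Set.Iio 0) = 0)
    {K y : ℝ} (hK : 0 < K) (hy : 0 < y) :
    y * ‖sqrtCauchyTransform ρ (y * Complex.I)‖ ^ 2 ≤ 2 * K / y + 4 * ρ.real {t | K < ‖t‖}
      * ‖(y * Complex.I) * cauchyTransform ρ (y * Complex.I) - 1‖ := by
  have hz := ofReal_mul_I_im_pos hy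
  have hψ := integral_mul_norm_inv_le hρ hy
  set S : Set ℝ := {t | K < ‖t‖} with hS
  have hms : MeasurableSet S := measurableSet_lt measurable_const measurable_norm
  have hi1 := (integrable_inv_sub_ofReal (ρ := ρ) hz).norm.indicator hms
  have hi2 := (integrable_ofReal_mul_inv_sub_ofReal (ρ := ρ) hz).norm
  have hi3 := (integrable_sqrt_div_sub_ofReal (ρ := ρ) hz).norm.indicator hms
  set R : ℝ → ℝ := fun t => ‖((y : ℂ) * Complex.I - t)⁻¹‖ with hR
  set Q : ℝ → ℝ := fun t => ‖(Real.sqrt t : ℂ) / ((y : ℂ) * Complex.I - t)‖ with hQ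
  have hQR : ∀ t, Q t = Real.sqrt t * R t := fun t => by
    simp only [hQ, hR]
    rw [div_eq_mul_inv, norm_mul, Complex.norm_real, Real.norm_eq_abs,
      abs_of_nonneg (Real.sqrt_nonneg t)]
  have hR0 : ∀ t, 0 ≤ R t := fun t => norm_nonneg _
  have hRy : ∀ t, R t ≤ y⁻¹ := fun t => norm_inv_mul_I_sub_le hy t
  set B := ∫ t, S.indicator Q t ∂ρ with hB
  set A := ∫ t : ℝ, ‖(t : ℂ) * ((y : ℂ) * Complex.I - t)⁻¹‖ ∂ρ with hA
  have hB0 : 0 ≤ B := integral_nonneg fun t => Set.indicator_nonneg (fun _ _ => norm_nonneg _) t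
  have hA0 : 0 ≤ A := integral_nonneg fun t => norm_nonneg _
  have hRS : ∫ t, S.indicator R t ∂ρ ≤ ρ.real S * y⁻¹ := by
    rw [← smul_eq_mul, ← integral_indicator_const _ hms]
    refine integral_mono hi1 ((integrable_const _).indicator hms) fun t => ?_
    exact Set.indicator_le_indicator (hRy t)
  have hCS : B ^ 2 ≤ (∫ t, S.indicator R t ∂ρ) * A := by
    have : discrim (∫ t, S.indicator R t ∂ρ) (-(2 * B)) A ≤ 0 := by
      refine discrim_le_zero fun x => ?_
      have : (∫ t, S.indicator R t ∂ρ) * (x * x) + -(2 * B) * x + A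
          = ∫ t : ℝ, ((x * x) * S.indicator R t + (-(2 * x)) * S.indicator Q t
            + ‖(t : ℂ) * ((y : ℂ) * Complex.I - t)⁻¹‖) ∂ρ := by
        have h12 : Integrable (fun t => (x * x) * S.indicator R t
            + (-(2 * x)) * S.indicator Q t) ρ := (hi1.const_mul _).add (hi3.const_mul _)
        rw [integral_add h12 hi2,
          integral_add (hi1.const_mul (x * x)) (hi3.const_mul (-(2 * x))), integral_const_mul,
          integral_const_mul]
        ring
      rw [this]
      refine integral_nonneg_of_ae ?_
      filter_upwards [ae_nonneg_of_measure_Iio hρ] with t ht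
      have h1 : ‖(t : ℂ) * ((y : ℂ) * Complex.I - t)⁻¹‖ = t * R t := by
        rw [norm_mul, Complex.norm_real, Real.norm_eq_abs, abs_of_nonneg ht]
      rw [h1, Pi.zero_apply]
      by_cases htS : t ∈ S
      · rw [Set.indicator_of_mem htS, Set.indicator_of_mem htS, hQR]
        have h2 : (x * x) * R t + (-(2 * x)) * (Real.sqrt t * R t) + t * R t
            = (x - Real.sqrt t) ^ 2 * R t := by
          have := Real.sq_sqrt ht
          linear_combination -(R t) * this
        rw [h2]
        exact mul_nonneg (sq_nonneg _) (hR0 t)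
      · rw [Set.indicator_of_notMem htS, Set.indicator_of_notMem htS, mul_zero, mul_zero]
        have := mul_nonneg ht (hR0 t)
        linarith
    rw [discrim] at this
    nlinarith
  have hW : ‖sqrtCauchyTransform ρ (y * Complex.I)‖ ≤ Real.sqrt K * y⁻¹ + B := by
    calc _ ≤ ∫ t, Q t ∂ρ := norm_integral_le_integral_norm _
      _ ≤ ∫ t, (Real.sqrt K * y⁻¹ + S.indicator Q t) ∂ρ := by
        refine integral_mono (integrable_sqrt_div_sub_ofReal hz).norm
          ((integrable_const _).add hi3) fun t => ?_
        change Q t ≤ Real.sqrt K * y⁻¹ + S.indicator Q t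
        by_cases htS : t ∈ S
        · rw [Set.indicator_of_mem htS]
          have : 0 ≤ Real.sqrt K * y⁻¹ := by positivity
          linarith
        · rw [Set.indicator_of_notMem htS, add_zero, hQR]
          have h1 : t ≤ K := (le_abs_self t).trans (not_lt.1 htS)
          gcongr
          exact hRy t
      _ = _ := by
        rw [integral_add (integrable_const _) hi3]
        simp [hB]
  have hm0 : 0 ≤ ρ.real S := measureReal_nonneg
  calc y * ‖sqrtCauchyTransform ρ (y * Complex.I)‖ ^ 2
      ≤ y * (Real.sqrt K * y⁻¹ + B) ^ 2 := by gcongr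
    _ ≤ y * (2 * (Real.sqrt K * y⁻¹) ^ 2 + 2 * B ^ 2) := by
        gcongr
        nlinarith [sq_nonneg (Real.sqrt K * y⁻¹ - B)]
    _ ≤ y * (2 * (Real.sqrt K * y⁻¹) ^ 2 + 2 * ((ρ.real S * y⁻¹) *
        (2 * ‖(y * Complex.I) * cauchyTransform ρ (y * Complex.I) - 1‖))) := by
        gcongr
        exact hCS.trans (by gcongr)
    _ = _ := by
        rw [mul_pow, Real.sq_sqrt hK.le]
        field_simp
        ring

/-- Along the imaginary axis the denominator stays away from zero. -/
lemma le_norm_mul_denominator {y : ℝ} (hy : 0 < y) {ψ φ : ℂ} (hψr : ψ.re ≤ 0) (hψi : ψ.im ≤ 0)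
    (hφr : φ.re ≤ 0) (hφi : φ.im ≤ 0) (hsmall : ‖ψ + φ + ψ * φ‖ ≤ 1 / 4) :
    (1 + y * (‖ψ‖ * ‖φ‖)) / 4 ≤ ‖(1 + ψ) * (1 + φ) - y * Complex.I * (ψ * φ)‖ := by
  set q := 1 - y * Complex.I * (ψ * φ) with hq
  have hQ : 0 ≤ (ψ * φ).im := by
    rw [Complex.mul_im]
    nlinarith [mul_nonneg (neg_nonneg.2 hψr) (neg_nonneg.2 hφi),
      mul_nonneg (neg_nonneg.2 hψi) (neg_nonneg.2 hφr)]
  have hqre : q.re = 1 + y * (ψ * φ).im := by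
    rw [hq, Complex.sub_re, mul_assoc, Complex.re_ofReal_mul, Complex.I_mul_re]
    simp
    ring
  have hqim : q.im = -(y * (ψ * φ).re) := by
    rw [hq, Complex.sub_im, mul_assoc, Complex.im_ofReal_mul, Complex.I_mul_im]
    simp
  have hyQ : 0 ≤ y * (ψ * φ).im := by positivity
  have h1 : 1 ≤ ‖q‖ := (by rw [hqre]; linarith : 1 ≤ q.re).trans (Complex.re_le_norm q)
  have h2 : y * (‖ψ‖ * ‖φ‖) ≤ ‖q‖ := by
    rw [← norm_mul, ← sq_le_sq₀ (by positivity) (norm_nonneg _), mul_pow,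
      ← Complex.normSq_eq_norm_sq, ← Complex.normSq_eq_norm_sq, Complex.normSq_apply,
      Complex.normSq_apply, hqre, hqim]
    nlinarith
  have h3 : q = ((1 + ψ) * (1 + φ) - y * Complex.I * (ψ * φ)) - (ψ + φ + ψ * φ) := by
    rw [hq]
    ring
  have h4 := norm_sub_le ((1 + ψ) * (1 + φ) - y * Complex.I * (ψ * φ)) (ψ + φ + ψ * φ)
  rw [← h3] at h4
  linarith

lemma tendsto_boolean_mult_transform {μ ν : Measure ℝ} [IsProbabilityMeasure μ]
    [IsProbabilityMeasure ν] (hμ : μ (Set.Iio 0) = 0) (hν : ν (Set.Iio 0) = 0) :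
    Tendsto (fun y : ℝ => (y * Complex.I) * (fun z : ℂ => cauchyTransform μ z
            + (sqrtCauchyTransform μ z) ^ 2 * ((z - 1) * cauchyTransform ν z - 1) /
                (z * cauchyTransform μ z * cauchyTransform ν z
                  - (z * cauchyTransform μ z - 1) * (z * cauchyTransform ν z - 1)))
          (y * Complex.I)) atTop (𝓝 1) := by
  set ψ : ℝ → ℂ := fun y => (y * Complex.I) * cauchyTransform μ (y * Complex.I) - 1 with hψ
  set φ : ℝ → ℂ := fun y => (y * Complex.I) * cauchyTransform ν (y * Complex.I) - 1 with hφ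
  have hψ0 : Tendsto ψ atTop (𝓝 0) := tendsto_mul_I_mul_cauchyTransform_sub_one
  have hφ0 : Tendsto φ atTop (𝓝 0) := tendsto_mul_I_mul_cauchyTransform_sub_one
  set E : ℝ → ℂ := fun y => (y * Complex.I) * (sqrtCauchyTransform μ (y * Complex.I)) ^ 2 *
    ((y * Complex.I) * φ y - (1 + φ y)) /
      ((1 + ψ y) * (1 + φ y) - y * Complex.I * (ψ y * φ y)) with hE
  have hsmall : ∀ᶠ y in atTop, ‖ψ y + φ y + ψ y * φ y‖ ≤ 1 / 4 := by
    have : Tendsto (fun y => ‖ψ y + φ y + ψ y * φ y‖) atTop (𝓝 0) := by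
      simpa using ((hψ0.add hφ0).add (hψ0.mul hφ0)).norm
    exact this.eventually_le_const (by norm_num)
  have hψ1 : ∀ᶠ y in atTop, ‖ψ y‖ ≤ 1 :=
    (by simpa using hψ0.norm : Tendsto (fun y => ‖ψ y‖) atTop (𝓝 0)).eventually_le_const
      one_pos
  have hφ1 : ∀ᶠ y in atTop, ‖φ y‖ ≤ 1 :=
    (by simpa using hφ0.norm : Tendsto (fun y => ‖φ y‖) atTop (𝓝 0)).eventually_le_const
      one_pos
  have hbound : ∀ K : ℝ, 0 < K → ∀ᶠ y in atTop,
      ‖E y‖ ≤ 4 * (2 * K * ‖φ y‖ + 4 * K * y⁻¹ + 12 * (2 * ‖ψ K‖)) := by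
    intro K hK
    filter_upwards [hsmall, hψ1, hφ1, eventually_gt_atTop 0] with y h1 h2 h3 hy
    have hz := ofReal_mul_I_im_pos hy
    have hm : μ.real {t | K < ‖t‖} ≤ 2 * ‖ψ K‖ := by
      rw [hψ, norm_sub_rev]
      exact measureReal_norm_gt_le hK
    have hD := le_norm_mul_denominator hy (mul_I_mul_cauchyTransform_sub_one_re_nonpos hy)
      (mul_cauchyTransform_sub_one_im_nonpos hμ hz)
      (mul_I_mul_cauchyTransform_sub_one_re_nonpos hy)
      (mul_cauchyTransform_sub_one_im_nonpos hν hz) h1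
    change (1 + y * (‖ψ y‖ * ‖φ y‖)) / 4
      ≤ ‖(1 + ψ y) * (1 + φ y) - y * Complex.I * (ψ y * φ y)‖ at hD
    have hW := mul_norm_sqrtCauchyTransform_sq_le hμ hK hy
    change _ ≤ _ + _ * ‖ψ y‖ at hW
    have hN : ‖(y * Complex.I) * φ y - (1 + φ y)‖ ≤ y * ‖φ y‖ + 2 := by
      refine (norm_sub_le _ _).trans ?_
      have h4 : ‖1 + φ y‖ ≤ 2 := (norm_add_le _ _).trans (by rw [norm_one]; linarith)
      rw [norm_mul, norm_mul, Complex.norm_I, mul_one, Complex.norm_real, Real.norm_eq_abs,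
        abs_of_pos hy]
      linarith
    have hpos : 0 < (1 + y * (‖ψ y‖ * ‖φ y‖)) / 4 := by positivity
    have hEn : ‖E y‖ ≤ (2 * K / y + 4 * (2 * ‖ψ K‖) * ‖ψ y‖) * (y * ‖φ y‖ + 2) /
        ((1 + y * (‖ψ y‖ * ‖φ y‖)) / 4) := by
      rw [hE]
      simp only [norm_div, norm_mul, norm_pow, Complex.norm_I, mul_one, Complex.norm_real,
        Real.norm_eq_abs, abs_of_pos hy]
      gcongr
      exact hW.trans (by gcongr)
    refine hEn.trans ?_
    rw [div_le_iff₀ hpos]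
    set α := ‖ψ y‖
    set β := ‖φ y‖
    set m := 2 * ‖ψ K‖
    have hα0 : 0 ≤ α := norm_nonneg _
    have hβ0 : 0 ≤ β := norm_nonneg _
    have hm0 : 0 ≤ m := by positivity
    have e1 : (2 * K / y + 4 * m * α) * (y * β + 2)
        = 2 * K * β + 4 * K * y⁻¹ + (4 * m * (y * (α * β)) + 8 * (m * α)) := by
      field_simp
      ring
    rw [e1]
    have e2 : 0 ≤ y * (α * β) := by positivity
    have e3 : 0 ≤ 2 * K * β + 4 * K * y⁻¹ := by positivity
    have e4 : m * α ≤ m := mul_le_of_le_one_right hm0 h2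
    nlinarith [mul_nonneg e3 e2, mul_nonneg hm0 e2]
  have hE0 : Tendsto E atTop (𝓝 0) := by
    rw [NormedAddGroup.tendsto_nhds_zero]
    intro ε hε
    obtain ⟨K, hKε, hK⟩ := ((show Tendsto (fun K => 96 * ‖ψ K‖) atTop (𝓝 0) by
      simpa using hψ0.norm.const_mul 96).eventually_lt_const (half_pos hε)).and
        (eventually_gt_atTop 0) |>.exists
    have hlim : Tendsto (fun y => 8 * K * ‖φ y‖ + 16 * K * y⁻¹) atTop (𝓝 0) := by
      simpa using (hφ0.norm.const_mul (8 * K)).add (tendsto_inv_atTop_zero.const_mul (16 * K))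
    filter_upwards [hbound K hK, hlim.eventually_lt_const (half_pos hε)] with y h1 h2
    linarith
  have hlim : Tendsto (fun y => 1 + ψ y + E y) atTop (𝓝 1) := by
    simpa using (hψ0.const_add 1).add hE0
  refine hlim.congr' ?_
  filter_upwards [eventually_gt_atTop 0] with y hy
  have hz0 : (y : ℂ) * Complex.I ≠ 0 := by simpa using hy.ne'
  simp only [hE, hψ, hφ]
  set z := (y : ℂ) * Complex.I
  set G := cauchyTransform μ z
  set H := cauchyTransform ν z
  have hD : (1 + (z * G - 1)) * (1 + (z * H - 1)) - z * ((z * G - 1) * (z * H - 1))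
      = z * (z * G * H - (z * G - 1) * (z * H - 1)) := by ring
  have hN : z * (z * H - 1) - (1 + (z * H - 1)) = z * ((z - 1) * H - 1) := by ring
  rw [hD, hN, mul_left_comm, mul_div_mul_left _ _ hz0]
  ring

end Asymptotics

/-- Existence and uniqueness of the probabilistically defined multiplicative boolean
convolution `μ ⊎̃ ν` of probability measures on `[0,∞)`: the denominator
`z·G_μ(z)·G_ν(z) − (z·G_μ(z)−1)·(z·G_ν(z)−1)` is nonzero on the upper half-plane, and there
is a unique probability measure on `[0,∞)` with the stated Cauchy transform. -/
theorem boolean_mult_convolution_exists_unique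
    (μ ν : Measure ℝ) [IsProbabilityMeasure μ] [IsProbabilityMeasure ν]
    (hμ : μ (Set.Iio 0) = 0) (hν : ν (Set.Iio 0) = 0) :
    (∀ z : ℂ, 0 < z.im →
      z * cauchyTransform μ z * cauchyTransform ν z
        - (z * cauchyTransform μ z - 1) * (z * cauchyTransform ν z - 1) ≠ 0) ∧
    ∃! l : Measure ℝ, IsProbabilityMeasure l ∧ l (Set.Iio 0) = 0 ∧
      ∀ z : ℂ, 0 < z.im →
        cauchyTransform l z
          = cauchyTransform μ z
            + (sqrtCauchyTransform μ z) ^ 2 * ((z - 1) * cauchyTransform ν z - 1) /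
                (z * cauchyTransform μ z * cauchyTransform ν z
                  - (z * cauchyTransform μ z - 1) * (z * cauchyTransform ν z - 1)) := by
  refine ⟨fun z hz => boolean_mult_denominator_ne_zero hν hz, ?_⟩
  choose l hl1 hl2 hl3 using fun n => exists_boolean_mult_convolution_of_simpleFunc μ ν
    (nonnegApprox_nonneg n) (nonnegApprox_nonneg n)
  obtain ⟨ρ, hρ1, hρ2, hρ3⟩ := exists_cauchyTransform_eq_of_tendsto hl2
    (F := fun z => cauchyTransform μ z
            + (sqrtCauchyTransform μ z) ^ 2 * ((z - 1) * cauchyTransform ν z - 1) /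
                (z * cauchyTransform μ z * cauchyTransform ν z
                  - (z * cauchyTransform μ z - 1) * (z * cauchyTransform ν z - 1)))
    (fun z hz => by
      have hG := tendsto_integral_map_nonnegApprox hμ (continuous_inv_sub_ofReal hz)
        (norm_inv_sub_ofReal_le hz)
      have hH := tendsto_integral_map_nonnegApprox hν (continuous_inv_sub_ofReal hz)
        (norm_inv_sub_ofReal_le hz)
      have hW := tendsto_integral_map_nonnegApprox hμ (continuous_sqrt_div_sub_ofReal hz)
        (norm_sqrt_div_sub_ofReal_le hz)
      simp_rw [fun n => hl3 n z hz]
      exact hG.add (((hW.pow 2).mul ((hH.const_mul (z - 1)).sub_const 1)).div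
        (((hG.const_mul z).mul hH).sub
          (((hG.const_mul z).sub_const 1).mul ((hH.const_mul z).sub_const 1)))
        (boolean_mult_denominator_ne_zero hν hz)))
    (tendsto_boolean_mult_transform hμ hν)
  refine ⟨ρ, ⟨hρ1, hρ2, hρ3⟩, ?_⟩
  rintro σ ⟨hσ1, -, hσ3⟩
  exact eq_of_cauchyTransform_eq fun z hz => (hσ3 z hz).trans (hρ3 z hz).symm
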